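/- The Jaccard distance on finite subsets of a fixed type, defined by J_δ(A,B) = |A △ B| / |A ∪ B| for A ∪ B nonempty and J_δ(∅,∅) = 0, is a metric: it is nonnegative, J_δ(A,B) = 0 if and only if A = B, it is symmetric, and it satisfies the triangle inequality. -/

import Mathlib

/-- The Jaccard distance on finite sets. -/
noncomputable def jaccardDist {α : Type*} [DecidableEq α] (A B : Finset α) : ℝ :=
  if A ∪ B = ∅ then 0 else ((symmDiff A B).card : ℝ) / ((A ∪ B).card : ℝ)

theorem jaccardDist_eq_div {α : Type*} [DecidableEq α] (A B : Finset α) :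
    jaccardDist A B = ((symmDiff A B).card : ℝ) / ((A ∪ B).card : ℝ) := by
  unfold jaccardDist
  split_ifs with h <;> simp [h]

theorem card_symmDiff_le_card_union {α : Type*} [DecidableEq α] (A B : Finset α) :
    (symmDiff A B).card ≤ (A ∪ B).card :=
  Finset.card_le_card symmDiff_le_sup

theorem card_symmDiff_div_card_le_jaccardDist {α : Type*} [DecidableEq α] {A B U : Finset α}
    (h : A ∪ B ⊆ U) : ((symmDiff A B).card : ℝ) / (U.card : ℝ) ≤ jaccardDist A B := by
  rw [jaccardDist_eq_div]
  rcases (A ∪ B).card.eq_zero_or_pos with h0 | h0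
  · have := card_symmDiff_le_card_union A B
    simp [show (symmDiff A B).card = 0 by omega]
  · gcongr

/-- Enlarging numerator and denominator by the same amount does not decrease the ratio. -/
theorem jaccardDist_le_add_div_add {α : Type*} [DecidableEq α] (A B C : Finset α) :
    jaccardDist A B ≤ ((symmDiff A B).card + (C \ (A ∪ B)).card : ℝ) /
      ((A ∪ B).card + (C \ (A ∪ B)).card : ℝ) := by
  rw [jaccardDist_eq_div]
  rcases (A ∪ B).card.eq_zero_or_pos with h0 | h0
  · rw [h0, Nat.cast_zero, div_zero]
    positivity
  · have h : ((symmDiff A B).card : ℝ) ≤ (A ∪ B).card := by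
      exact_mod_cast card_symmDiff_le_card_union A B
    rw [div_le_div_iff₀ (by positivity) (by positivity)]
    nlinarith [mul_le_mul_of_nonneg_right h (Nat.cast_nonneg (α := ℝ) (C \ (A ∪ B)).card)]

theorem card_symmDiff_add_card_sdiff_le {α : Type*} [DecidableEq α] (A B C : Finset α) :
    (symmDiff A B).card + (C \ (A ∪ B)).card ≤ (symmDiff A C).card + (symmDiff C B).card := by
  have hd : Disjoint (symmDiff A B) (C \ (A ∪ B)) :=
    Finset.disjoint_sdiff.mono_left symmDiff_le_sup
  rw [← Finset.card_union_of_disjoint hd]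
  refine (Finset.card_le_card fun x => ?_).trans (Finset.card_union_le _ _)
  simp only [Finset.mem_union, Finset.mem_symmDiff, Finset.mem_sdiff]
  tauto

theorem jaccardDist_triangle {α : Type*} [DecidableEq α] (A B C : Finset α) :
    jaccardDist A B ≤ jaccardDist A C + jaccardDist C B := by
  have hU : ((A ∪ B).card + (C \ (A ∪ B)).card : ℝ) = ((A ∪ B) ∪ C).card := by
    rw [← Finset.union_sdiff_self_eq_union (s := A ∪ B),
      Finset.card_union_of_disjoint Finset.disjoint_sdiff, Nat.cast_add]
  calc jaccardDist A B
      ≤ ((symmDiff A B).card + (C \ (A ∪ B)).card : ℝ) / ((A ∪ B) ∪ C).card :=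
        hU ▸ jaccardDist_le_add_div_add A B C
    _ ≤ ((symmDiff A C).card + (symmDiff C B).card : ℝ) / ((A ∪ B) ∪ C).card := by
        gcongr ?_ / _
        exact_mod_cast card_symmDiff_add_card_sdiff_le A B C
    _ ≤ jaccardDist A C + jaccardDist C B := by
        rw [add_div]
        exact add_le_add (card_symmDiff_div_card_le_jaccardDist (by grind))
          (card_symmDiff_div_card_le_jaccardDist (by grind))

theorem jaccardDist_eq_zero_iff {α : Type*} [DecidableEq α] (A B : Finset α) :
    jaccardDist A B = 0 ↔ A = B := by
  have h := card_symmDiff_le_card_union A B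
  rw [jaccardDist_eq_div, div_eq_zero_iff, Nat.cast_eq_zero, Nat.cast_eq_zero,
    or_iff_left_of_imp (by omega), Finset.card_eq_zero]
  exact symmDiff_eq_bot

theorem jaccardDist_is_metric {α : Type*} [DecidableEq α] :
    (∀ A B : Finset α, 0 ≤ jaccardDist A B) ∧
    (∀ A B : Finset α, jaccardDist A B = 0 ↔ A = B) ∧
    (∀ A B : Finset α, jaccardDist A B = jaccardDist B A) ∧
    (∀ A B C : Finset α, jaccardDist A B ≤ jaccardDist A C + jaccardDist C B) := by
  refine ⟨fun A B => ?_, jaccardDist_eq_zero_iff, fun A B => ?_, jaccardDist_triangle⟩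
  · rw [jaccardDist_eq_div]
    positivity
  · rw [jaccardDist_eq_div, jaccardDist_eq_div, symmDiff_comm, Finset.union_comm]
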